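/- arXiv:1909.09264 — 2 statements merged into one kernel-verified Lean document; each statement's English description precedes it below -/
import Mathlib

section
/- Let μ be a measure on ℝ^d absolutely continuous with respect to Lebesgue measure, and let f : ℝ^d → ℝ be an analytic function that is not identically zero. Then the zero set {x ∈ ℝ^d : f(x) = 0} has μ-measure zero. -/
open MeasureTheory

theorem aux_one (g : ℝ → ℝ) (hg : ∀ x, AnalyticAt ℝ g x) (a : ℝ) (ha : g a ≠ 0) :
    ∀ᵐ t, g t ≠ 0 := by
  have h := AnalyticOnNhd.preimage_zero_mem_codiscrete (f := g) (x := a) (fun x _ => hg x) ha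
  have h2 := ae_restrict_le_codiscreteWithin (μ := (volume : Measure ℝ))
    (U := Set.univ) MeasurableSet.univ
  rw [Measure.restrict_univ] at h2
  filter_upwards [h2 h] with t ht
  simpa using ht

theorem aux_vol (d : ℕ) (f : (Fin d → ℝ) → ℝ) (hf : ∀ x, AnalyticAt ℝ f x)
    (a : Fin d → ℝ) (ha : f a ≠ 0) : volume {x | f x = 0} = 0 := by
  induction d with
  | zero =>
    have : {x | f x = 0} = ∅ := by
      ext x
      simp [Subsingleton.elim x a, ha]
    simp [this]
  | succ n ih =>
    have hm : MeasurableSet {x | f x = 0} :=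
      (isClosed_singleton.preimage
        (continuous_iff_continuousAt.2 fun x => (hf x).continuousAt)).measurableSet
    have hcons : ∀ (p : ℝ × (Fin n → ℝ)),
        AnalyticAt ℝ (fun p : ℝ × (Fin n → ℝ) => (Fin.cons p.1 p.2 : Fin (n+1) → ℝ)) p := by
      intro p
      rw [analyticAt_pi_iff]
      intro i
      refine Fin.cases ?_ (fun j => ?_) i
      · simpa using analyticAt_fst
      · simp only [Fin.cons_succ]
        exact ((ContinuousLinearMap.proj (R := ℝ) (φ := fun _ : Fin n => ℝ) j).comp
          (ContinuousLinearMap.snd ℝ ℝ (Fin n → ℝ))).analyticAt p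
    have hF : ∀ p : ℝ × (Fin n → ℝ),
        AnalyticAt ℝ (fun p : ℝ × (Fin n → ℝ) => f (Fin.cons p.1 p.2)) p :=
      fun p => (hf _).comp (hcons p)
    have mp := (volume_preserving_piFinSuccAbove (fun _ : Fin (n+1) => ℝ) 0).symm
    rw [← mp.measure_preimage hm.nullMeasurableSet]
    have hs := mp.measurable hm
    refine (Measure.measure_prod_null hs).2 ?_
    have h1 : ∀ᵐ t : ℝ, f (Fin.cons t (Fin.tail a)) ≠ 0 := by
      refine aux_one (fun t => f (Fin.cons t (Fin.tail a))) (fun t => ?_) (a 0) ?_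
      · exact (hF (t, Fin.tail a)).comp (f := fun t : ℝ => (t, Fin.tail a))
          (analyticAt_id.prod analyticAt_const)
      · simpa using ha
    filter_upwards [h1] with t ht
    have := ih (fun y => f (Fin.cons t y)) (fun y =>
      (hF (t, y)).comp (f := fun y => (t, y))
          (analyticAt_const.prod analyticAt_id)) _ ht
    simpa [Set.preimage, MeasurableEquiv.piFinSuccAbove, Fin.consEquiv] using this

/-- If `μ` is a measure on `ℝ^d` absolutely continuous with respect to
Lebesgue measure and `f : ℝ^d → ℝ` is analytic (everywhere) and not identically zero,
then the zero set of `f` has `μ`-measure zero. -/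
theorem zero_set_of_analytic_null (d : ℕ)
    (μ : Measure (Fin d → ℝ)) (hμ : μ ≪ volume)
    (f : (Fin d → ℝ) → ℝ) (hf : ∀ x, AnalyticAt ℝ f x)
    (hne : f ≠ fun _ => 0) :
    μ {x | f x = 0} = 0 := by
  obtain ⟨a, ha⟩ := Function.ne_iff.1 hne
  exact hμ (aux_vol d f hf a ha)
end

section
/- Let J ≥ 2, let x be a random vector in ℝ^J, set z := min_{j∈{1,…,J}} |x_j|, and let ε > 0, γ > 0. If ℙ(z ≥ ε) ≥ 1 − γ, then with probability at least 1 − γ the following holds: for all t₁ ≥ t₂ ≥ 0, if ε ≥ √((t₁² − t₂²)/(J(J−1))), then ‖x‖₂ > t₂ implies ‖x‖₁ > t₁. -/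
open MeasureTheory ProbabilityTheory

theorem aux_sum_sq (J : ℕ) (a : Fin J → ℝ) (hJ : 2 ≤ J) (ε : ℝ) (hε : 0 < ε)
    (ha : ∀ j, ε ≤ a j) :
    (∑ j, a j ^ 2) + J * (J - 1) * ε ^ 2 ≤ (∑ j, a j) ^ 2 := by
  have hJ' : (2 : ℝ) ≤ J := by exact_mod_cast hJ
  have h1 : (J : ℝ) * ε ≤ ∑ j, a j := by
    have := Finset.sum_le_sum (s := Finset.univ) (fun j _ => ha j)
    simpa using this
  have h2 : ∀ i, a i + (J - 1) * ε ≤ ∑ j, a j := by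
    intro i
    rw [← Finset.add_sum_erase Finset.univ a (Finset.mem_univ i)]
    have := Finset.sum_le_sum (s := Finset.univ.erase i) (fun j _ => ha j)
    rw [Finset.sum_const, Finset.card_erase_of_mem (Finset.mem_univ i), nsmul_eq_mul,
      Finset.card_univ, Fintype.card_fin, Nat.cast_sub (by omega), Nat.cast_one] at this
    linarith
  have h3 : ∑ i, (a i ^ 2 + (J - 1) * ε * a i) ≤ ∑ i, a i * ∑ j, a j := by
    refine Finset.sum_le_sum fun i _ => ?_
    have := mul_le_mul_of_nonneg_left (h2 i) (hε.le.trans (ha i))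
    linarith
  rw [Finset.sum_add_distrib, ← Finset.mul_sum, ← Finset.sum_mul] at h3
  have h4 := mul_le_mul_of_nonneg_left h1 (mul_nonneg (by linarith : (0:ℝ) ≤ J - 1) hε.le)
  nlinarith

/-- Let `x` be a random vector in `ℝ^J` with `J ≥ 2` and
`z = min_j |x_j|`.  If `ℙ(z ≥ ε) ≥ 1 - γ` then with probability at least `1 - γ`:
for all `t₁ ≥ t₂ ≥ 0`, if `ε ≥ √((t₁² - t₂²)/(J(J-1)))`, then `‖x‖₂ > t₂` implies
`‖x‖₁ > t₁`. -/
theorem l1_vs_l2_rejection (J : ℕ) (hJ : 2 ≤ J)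
    (Ω : Type*) [MeasureSpace Ω] [IsProbabilityMeasure (ℙ : Measure Ω)]
    (x : Ω → Fin J → ℝ) (hx : Measurable x)
    (ε γ : ℝ) (hε : 0 < ε) (hγ : 0 < γ)
    (h : ENNReal.ofReal (1 - γ) ≤ ℙ {ω | ε ≤ ⨅ j : Fin J, |x ω j|}) :
    ENNReal.ofReal (1 - γ) ≤
      ℙ {ω | ∀ t₁ t₂ : ℝ, 0 ≤ t₂ → t₂ ≤ t₁ →
        Real.sqrt ((t₁ ^ 2 - t₂ ^ 2) / (J * (J - 1))) ≤ ε →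
        Real.sqrt (∑ j, (x ω j) ^ 2) > t₂ → (∑ j, |x ω j|) > t₁} := by
  refine h.trans (measure_mono ?_)
  intro ω hω t₁ t₂ h0 h12 hs h2
  have hω' : ε ≤ ⨅ j : Fin J, |x ω j| := hω
  have ha : ∀ j, ε ≤ |x ω j| := fun j =>
    hω'.trans (ciInf_le (Set.finite_range _).bddBelow j)
  have key := aux_sum_sq J (fun j => |x ω j|) hJ ε hε ha
  simp only [sq_abs] at key
  have hJ' : (2 : ℝ) ≤ J := by exact_mod_cast hJ
  have hp : (0 : ℝ) < J * (J - 1) := mul_pos (by linarith) (by linarith)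
  rw [Real.sqrt_le_left hε.le, div_le_iff₀ hp] at hs
  have h3 := (Real.lt_sqrt h0).1 h2
  exact lt_of_pow_lt_pow_left₀ 2 (Finset.sum_nonneg fun j _ => abs_nonneg _) (by linarith)
end
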